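/- The refined-profile remainder has uniform exponential weight e^{-|x|}: there exist constants δ₀ > 0 and C > 0 such that for all real numbers α, β with |α| + |β| ≤ δ₀ and every real x, | f(Q(x) + α φ₀(x) + β φ₂(x)) - f(Q(x)) - p Q(x)^{p-1} (α φ₀(x) + β φ₂(x)) | ≤ C (α² + β²) e^{-|x|}. -/

import Mathlib

open Real

/-- The soliton `Q(x) = ((p+1)/2)^{1/(p-1)} (sech(β₀x))^{2/(p-1)}` with `β₀ = (p-1)/2`,
where `sech t = 1 / cosh t`. -/
noncomputable def solitonQ (p : ℝ) : ℝ → ℝ :=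
  fun x => ((p + 1) / 2) ^ (1 / (p - 1)) * ((Real.cosh ((p - 1) / 2 * x))⁻¹) ^ (2 / (p - 1))

/-- The nonlinearity `f(u) = |u|^{p-1} u`. -/
noncomputable def fNL (p : ℝ) : ℝ → ℝ :=
  fun u => |u| ^ (p - 1) * u

/-- The operator `(S_j* g)(x) = -g'(x) - k tanh(β₀x) g(x)` with `β₀ = (p-1)/2`,
for a constant `k`. -/
noncomputable def Sstar (p k : ℝ) (g : ℝ → ℝ) : ℝ → ℝ :=
  fun x => -(deriv g x) - k * Real.tanh ((p - 1) / 2 * x) * g x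

/-- `φ₀ = Q^{k₀}` with `k₀ = (p+1)/2`. -/
noncomputable def phi0 (p : ℝ) : ℝ → ℝ :=
  fun x => solitonQ p x ^ ((p + 1) / 2)

/-- `φ₂ = S₀*(S₁*(Q^{k₂}))` where `k₀ = (p+1)/2`, `k₁ = 1`, `k₂ = (3-p)/2`. -/
noncomputable def phi2 (p : ℝ) : ℝ → ℝ :=
  Sstar p ((p + 1) / 2) (Sstar p 1 (fun x => solitonQ p x ^ ((3 - p) / 2)))

lemma abs_fNL_one_add_sub_le {p : ℝ} (hp1 : 1 ≤ p) (hp2 : p ≤ 2) (t : ℝ) :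
    |fNL p (1 + t) - 1 - p * t| ≤ 4 * t ^ 2 := by
  unfold fNL
  rcases le_or_gt (-1) t with ht | ht
  · have h0 : 0 ≤ 1 + t := by linarith
    rw [abs_of_nonneg h0]
    have hpow : (1 + t) ^ (p - 1) * (1 + t) = (1 + t) ^ p := by
      rcases h0.eq_or_lt with h | h
      · rw [← h, mul_zero, Real.zero_rpow (by linarith)]
      · rw [Real.rpow_sub_one h.ne', div_mul_cancel₀ _ h.ne']
    have hlow : 1 + p * t ≤ (1 + t) ^ p := one_add_mul_self_le_rpow_one_add ht hp1
    have hup : (1 + t) ^ (p - 1) ≤ 1 + (p - 1) * t :=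
      rpow_one_add_le_one_add_mul_self ht (by linarith) (by linarith)
    have hmul := mul_le_mul_of_nonneg_right hup h0
    rw [abs_le]
    constructor <;> nlinarith [sq_nonneg t]
  · have h0 : 0 < -(1 + t) := by linarith
    have hs : 0 ≤ |1 + t| ^ (p - 1) := Real.rpow_nonneg (abs_nonneg _) _
    have hs' : |1 + t| ^ (p - 1) ≤ -t := by
      rw [abs_of_neg (by linarith)]
      calc (-(1 + t)) ^ (p - 1) ≤ (-t) ^ (p - 1) :=
            Real.rpow_le_rpow h0.le (by linarith) (by linarith)
        _ ≤ (-t) ^ (1 : ℝ) := Real.rpow_le_rpow_of_exponent_le (by linarith) (by linarith)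
        _ = -t := Real.rpow_one _
    have hmul : |1 + t| ^ (p - 1) * -(1 + t) ≤ -t * -t :=
      mul_le_mul hs' (by linarith) h0.le (by linarith)
    have hmul' : 0 ≤ |1 + t| ^ (p - 1) * -(1 + t) := mul_nonneg hs h0.le
    rw [abs_le]
    constructor <;> nlinarith

/-- Second-order Taylor bound for `fNL p` at a positive point, uniform in the increment. -/
lemma abs_fNL_add_sub_le {p : ℝ} (hp1 : 1 ≤ p) (hp2 : p ≤ 2) {q : ℝ} (hq : 0 < q) (h : ℝ) :
    |fNL p (q + h) - fNL p q - p * q ^ (p - 1) * h| ≤ 4 * (q ^ (p - 2) * h ^ 2) := by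
  have key := abs_fNL_one_add_sub_le hp1 hp2 (h / q)
  have hqp : 0 < q ^ (p - 2) := Real.rpow_pos_of_pos hq _
  have h1 : q ^ (p - 1) = q ^ (p - 2) * q := by
    rw [← Real.rpow_add_one hq.ne']; ring_nf
  have hqh : q + h = q * (1 + h / q) := by field_simp
  have heq : fNL p (q + h) - fNL p q - p * q ^ (p - 1) * h
      = q ^ (p - 2) * q ^ 2 * (fNL p (1 + h / q) - 1 - p * (h / q)) := by
    rw [hqh]
    unfold fNL
    rw [abs_mul, abs_of_pos hq, Real.mul_rpow hq.le (abs_nonneg _), h1]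
    field_simp
  rw [heq, abs_mul, abs_of_pos (by positivity)]
  calc q ^ (p - 2) * q ^ 2 * |fNL p (1 + h / q) - 1 - p * (h / q)|
      ≤ q ^ (p - 2) * q ^ 2 * (4 * (h / q) ^ 2) := by gcongr
    _ = 4 * (q ^ (p - 2) * h ^ 2) := by field_simp

lemma solitonQ_pos {p : ℝ} (hp : 1 < p) (x : ℝ) : 0 < solitonQ p x := by
  unfold solitonQ
  have := Real.cosh_pos ((p - 1) / 2 * x)
  have : 0 < (p + 1) / 2 := by linarith
  positivity

lemma hasDerivAt_tanh (x : ℝ) : HasDerivAt Real.tanh (1 - Real.tanh x ^ 2) x := by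
  have hc := (Real.cosh_pos x).ne'
  have h := (Real.hasDerivAt_sinh x).div (Real.hasDerivAt_cosh x) hc
  have hf : Real.tanh = Real.sinh / Real.cosh := by
    funext y
    exact Real.tanh_eq_sinh_div_cosh y
  rw [hf]
  refine h.congr_deriv ?_
  simp only [Pi.div_apply]
  field_simp

lemma hasDerivAt_solitonQ {p : ℝ} (hp : 1 < p) (x : ℝ) :
    HasDerivAt (solitonQ p) (-(Real.tanh ((p - 1) / 2 * x) * solitonQ p x)) x := by
  have hc := Real.cosh_pos ((p - 1) / 2 * x)
  have hlin : HasDerivAt (fun y : ℝ => (p - 1) / 2 * y) ((p - 1) / 2) x := by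
    simpa using (hasDerivAt_id x).const_mul ((p - 1) / 2)
  have h := ((hlin.cosh.fun_inv hc.ne').rpow_const (p := 2 / (p - 1))
    (Or.inl (inv_pos.2 hc).ne')).const_mul (((p + 1) / 2) ^ (1 / (p - 1)))
  refine h.congr_deriv ?_
  have hp' : p - 1 ≠ 0 := by linarith
  unfold solitonQ
  rw [Real.rpow_sub_one (inv_pos.2 hc).ne', Real.tanh_eq_sinh_div_cosh]
  field_simp

lemma hasDerivAt_solitonQ_rpow {p : ℝ} (hp : 1 < p) (k x : ℝ) :
    HasDerivAt (fun y => solitonQ p y ^ k)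
      (-(k * Real.tanh ((p - 1) / 2 * x) * solitonQ p x ^ k)) x := by
  have hQ := (solitonQ_pos hp x).ne'
  refine ((hasDerivAt_solitonQ hp x).rpow_const (p := k) (Or.inl hQ)).congr_deriv ?_
  rw [Real.rpow_sub_one hQ]
  field_simp

lemma phi2_eq {p : ℝ} (hp : 1 < p) (x : ℝ) :
    phi2 p x = ((p - 1) / 2) ^ 2 * (1 + Real.tanh ((p - 1) / 2 * x) ^ 2)
      * solitonQ p x ^ ((3 - p) / 2) := by
  have h1 : Sstar p 1 (fun y => solitonQ p y ^ ((3 - p) / 2)) = fun y =>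
      (1 - p) / 2 * (Real.tanh ((p - 1) / 2 * y) * solitonQ p y ^ ((3 - p) / 2)) := by
    funext y
    unfold Sstar
    rw [(hasDerivAt_solitonQ_rpow hp _ y).deriv]
    ring
  have hlin : HasDerivAt (fun y : ℝ => (p - 1) / 2 * y) ((p - 1) / 2) x := by
    simpa using (hasDerivAt_id x).const_mul ((p - 1) / 2)
  have htanh : HasDerivAt (fun y : ℝ => Real.tanh ((p - 1) / 2 * y))
      ((1 - Real.tanh ((p - 1) / 2 * x) ^ 2) * ((p - 1) / 2)) x :=
    (hasDerivAt_tanh _).comp x hlin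
  unfold phi2
  rw [h1, Sstar, ((htanh.fun_mul (hasDerivAt_solitonQ_rpow hp _ x)).const_mul _).deriv]
  ring

lemma abs_phi2_le {p : ℝ} (hp1 : 1 < p) (hp2 : p ≤ 2) (x : ℝ) :
    |phi2 p x| ≤ solitonQ p x ^ ((3 - p) / 2) := by
  have hQ := Real.rpow_pos_of_pos (solitonQ_pos hp1 x) ((3 - p) / 2)
  have ht : Real.tanh ((p - 1) / 2 * x) ^ 2 ≤ 1 := by
    rw [sq_le_one_iff_abs_le_one]
    exact (Real.abs_tanh_lt_one _).le
  rw [phi2_eq hp1, abs_of_nonneg (by positivity)]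
  refine mul_le_of_le_one_left hQ.le ?_
  have hb : ((p - 1) / 2) ^ 2 ≤ 1 / 4 := by nlinarith
  nlinarith [sq_nonneg ((p - 1) / 2), sq_nonneg (Real.tanh ((p - 1) / 2 * x))]

lemma solitonQ_le {p : ℝ} (hp : 1 < p) (x : ℝ) :
    solitonQ p x ≤ ((p + 1) / 2) ^ (1 / (p - 1)) * 2 ^ (2 / (p - 1)) * Real.exp (-|x|) := by
  have hp' : 0 < p - 1 := by linarith
  have hcosh : (Real.cosh ((p - 1) / 2 * x))⁻¹ ≤ 2 * Real.exp (-((p - 1) / 2 * |x|)) := by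
    rw [← Real.cosh_abs, abs_mul, abs_of_pos (half_pos hp'), Real.exp_neg]
    set y := (p - 1) / 2 * |x|
    have hy := Real.exp_pos y
    rw [inv_le_comm₀ (Real.cosh_pos y) (by positivity), mul_inv, inv_inv, Real.cosh_eq]
    linarith [Real.exp_pos (-y)]
  have hc := Real.cosh_pos ((p - 1) / 2 * x)
  have : 0 < (p + 1) / 2 := by linarith
  unfold solitonQ
  rw [mul_assoc]
  gcongr
  calc _ ≤ (2 * Real.exp (-((p - 1) / 2 * |x|))) ^ (2 / (p - 1)) :=
        Real.rpow_le_rpow (inv_pos.2 hc).le hcosh (by positivity)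
    _ = _ := by
        rw [Real.mul_rpow (by norm_num) (Real.exp_pos _).le, ← Real.exp_mul]
        congr 2
        field_simp

theorem stmt11 (p : ℝ) (hp1 : 5 / 3 < p) (hp2 : p ≤ 2) :
    ∃ δ₀ > (0 : ℝ), ∃ C > (0 : ℝ), ∀ α β : ℝ, |α| + |β| ≤ δ₀ → ∀ x : ℝ,
      |fNL p (solitonQ p x + α * phi0 p x + β * phi2 p x) - fNL p (solitonQ p x)
          - p * solitonQ p x ^ (p - 1) * (α * phi0 p x + β * phi2 p x)|
        ≤ C * (α ^ 2 + β ^ 2) * Real.exp (-|x|) := by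
  have hp : 1 < p := by linarith
  set A : ℝ := ((p + 1) / 2) ^ (1 / (p - 1)) * 2 ^ (2 / (p - 1)) with hA
  have hApos : 0 < A := by
    have : 0 < (p + 1) / 2 := by linarith
    positivity
  set K : ℝ := A ^ (p - 1) + 1 with hK
  have hAp : 0 < A ^ (p - 1) := Real.rpow_pos_of_pos hApos _
  refine ⟨1, one_pos, 8 * K ^ 2 * A, by positivity, fun α β _ x => ?_⟩
  have hq := solitonQ_pos hp x
  have hqe := solitonQ_le hp x
  rw [← hA] at hqe
  have hqA : solitonQ p x ≤ A :=
    hqe.trans (mul_le_of_le_one_right hApos.le (Real.exp_le_one_iff.2 (by simp)))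
  have hphi2 := abs_phi2_le hp hp2 x
  set q := solitonQ p x with hqdef
  set r := q ^ ((3 - p) / 2) with hr
  have hrpos : 0 < r := Real.rpow_pos_of_pos hq _
  have hphi0 : |phi0 p x| ≤ A ^ (p - 1) * r := by
    have : phi0 p x = q ^ (p - 1) * r := by
      rw [hr, ← Real.rpow_add hq, phi0, ← hqdef]
      ring_nf
    rw [this, abs_of_pos (mul_pos (Real.rpow_pos_of_pos hq _) hrpos)]
    gcongr
  have hh : |α * phi0 p x + β * phi2 p x| ≤ (|α| + |β|) * K * r := by
    calc _ ≤ |α| * |phi0 p x| + |β| * |phi2 p x| := by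
          simpa only [abs_mul] using abs_add_le (α * phi0 p x) (β * phi2 p x)
      _ ≤ |α| * (K * r) + |β| * (K * r) := by
          gcongr
          · exact hphi0.trans (by rw [hK]; nlinarith)
          · exact hphi2.trans (by rw [hK]; nlinarith)
      _ = _ := by ring
  have hsq : (α * phi0 p x + β * phi2 p x) ^ 2 ≤ 2 * (α ^ 2 + β ^ 2) * (K ^ 2 * r ^ 2) := by
    calc _ = |α * phi0 p x + β * phi2 p x| ^ 2 := (sq_abs _).symm
      _ ≤ ((|α| + |β|) * K * r) ^ 2 := by gcongr
      _ = (|α| + |β|) ^ 2 * (K ^ 2 * r ^ 2) := by ring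
      _ ≤ _ := by
          gcongr
          nlinarith [sq_nonneg (|α| - |β|), sq_abs α, sq_abs β]
  have hpow : q ^ (p - 2) * r ^ 2 = q := by
    rw [hr, ← Real.rpow_natCast, ← Real.rpow_mul hq.le, ← Real.rpow_add hq]
    convert Real.rpow_one q using 2
    push_cast
    ring
  have hq2 : 0 < q ^ (p - 2) := Real.rpow_pos_of_pos hq _
  rw [add_assoc]
  calc _ ≤ 4 * (q ^ (p - 2) * (α * phi0 p x + β * phi2 p x) ^ 2) :=
        abs_fNL_add_sub_le hp.le hp2 hq _
    _ ≤ 4 * (q ^ (p - 2) * (2 * (α ^ 2 + β ^ 2) * (K ^ 2 * r ^ 2))) := by gcongr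
    _ = 8 * K ^ 2 * (α ^ 2 + β ^ 2) * (q ^ (p - 2) * r ^ 2) := by ring
    _ ≤ 8 * K ^ 2 * (α ^ 2 + β ^ 2) * (A * Real.exp (-|x|)) := by
        rw [hpow]
        gcongr
    _ = _ := by ring
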